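/- For every α ∈ {1, n−1}, every f ∈ {e_α, he_α}, and all x₁, x₂ ∈ sl₂(ℂ) one has e₀(x₁) · f(x₂) + f(x₂) · e₀(x₁) = 0. -/

import Mathlib

open scoped BigOperators

/-- The algebra of `2 × 2` complex matrices. -/
abbrev M2 : Type := Matrix (Fin 2) (Fin 2) ℂ

/-- The diagonal matrix `D = diag(1, ω)`. -/
noncomputable def Dmat (ω : ℂ) : M2 := Matrix.diagonal ![1, ω]

/-- The linear map `e_i : M₂(ℂ) → M₂(ℂ)`, `e_i(x) = (1/n) ∑_{j=0}^{n-1} ω^{-i j} D^j x D^{-j}`. -/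
noncomputable def eM (n : ℕ) (ω : ℂ) (i : ℕ) (x : M2) : M2 :=
  (n : ℂ)⁻¹ • ∑ j ∈ Finset.range n, (ω ^ (i * j))⁻¹ • (Dmat ω ^ j * x * (Dmat ω ^ j)⁻¹)

/-- The matrix `H = e₁₂ + e₂₁`. -/
noncomputable def Hmat : M2 := !![0, 1; 1, 0]

/-- The map `he_i(x) = H ⬝ e_i(x) ⬝ H`. -/
noncomputable def hem (n : ℕ) (ω : ℂ) (i : ℕ) (x : M2) : M2 := Hmat * eM n ω i x * Hmat

theorem Dmat_conj_apply {ω : ℂ} (hω : ω ≠ 0) (j : ℕ) (x : M2) (a b : Fin 2) :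
    (Dmat ω ^ j * x * (Dmat ω ^ j)⁻¹) a b = ![1, ω] a ^ j * x a b * (![1, ω] b ^ j)⁻¹ := by
  have hinv : (Dmat ω ^ j)⁻¹ = Matrix.diagonal fun b => ((![1, ω] : Fin 2 → ℂ) b ^ j)⁻¹ := by
    apply Matrix.inv_eq_right_inv
    rw [Dmat, Matrix.diagonal_pow, Matrix.diagonal_mul_diagonal, ← Matrix.diagonal_one]
    congr 1
    funext b
    fin_cases b <;> simp [hω]
  rw [hinv, Matrix.mul_diagonal, Dmat, Matrix.diagonal_pow, Matrix.diagonal_mul, Pi.pow_apply]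

theorem eM_apply (n : ℕ) {ω : ℂ} (hω : ω ≠ 0) (i : ℕ) (x : M2) (a b : Fin 2) :
    eM n ω i x a b = (n : ℂ)⁻¹ * ∑ j ∈ Finset.range n,
      (ω ^ (i * j))⁻¹ * (![1, ω] a ^ j * x a b * (![1, ω] b ^ j)⁻¹) := by
  simp only [eM, Matrix.smul_apply, Matrix.sum_apply, Dmat_conj_apply hω, smul_eq_mul]

theorem geom_sum_eq_zero_of_pow_eq_one {K : Type*} [Field K] {z : K} {n : ℕ} (hz : z ≠ 1)
    (hzn : z ^ n = 1) : ∑ j ∈ Finset.range n, z ^ j = 0 := by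
  rw [geom_sum_eq hz, hzn, sub_self, zero_div]

theorem eM_apply_self_of_not_dvd {n : ℕ} {ω : ℂ} (hω : IsPrimitiveRoot ω n) (hω₀ : ω ≠ 0)
    {i : ℕ} (hi : ¬ n ∣ i) (x : M2) (a : Fin 2) : eM n ω i x a a = 0 := by
  have hz : (ω ^ i)⁻¹ ≠ 1 := by
    rwa [Ne, inv_eq_one, hω.pow_eq_one_iff_dvd]
  have hzn : (ω ^ i)⁻¹ ^ n = 1 := by
    rw [inv_pow, pow_right_comm, hω.pow_eq_one, one_pow, inv_one]
  have hd (j : ℕ) : (![1, ω] a : ℂ) ^ j ≠ 0 := by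
    fin_cases a <;> simp [hω₀]
  have hterm (j : ℕ) : (ω ^ (i * j))⁻¹ * (![1, ω] a ^ j * x a a * (![1, ω] a ^ j)⁻¹) =
      (ω ^ i)⁻¹ ^ j * x a a := by
    rw [mul_right_comm (![1, ω] a ^ j), mul_inv_cancel₀ (hd j), one_mul, pow_mul, inv_pow]
  rw [eM_apply n hω₀]
  simp only [hterm]
  rw [← Finset.sum_mul, geom_sum_eq_zero_of_pow_eq_one hz hzn, zero_mul, mul_zero]

theorem eM_zero_apply_of_ne {n : ℕ} {ω : ℂ} (hω : IsPrimitiveRoot ω n) (hω₀ : ω ≠ 0)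
    (hω₁ : ω ≠ 1) (x : M2) {a b : Fin 2} (hab : a ≠ b) : eM n ω 0 x a b = 0 := by
  have h₁ := geom_sum_eq_zero_of_pow_eq_one hω₁ hω.pow_eq_one
  have h₂ := geom_sum_eq_zero_of_pow_eq_one (inv_ne_one.mpr hω₁) hω.inv.pow_eq_one
  simp only [inv_pow] at h₂
  rw [eM_apply n hω₀]
  fin_cases a <;> fin_cases b <;> simp_all [← Finset.sum_mul, ← Finset.mul_sum]

theorem trace_eM (n : ℕ) {ω : ℂ} (hω : ω ≠ 0) (i : ℕ) {x : M2} (hx : x.trace = 0) :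
    (eM n ω i x).trace = 0 := by
  rw [Matrix.trace_fin_two] at hx
  rw [Matrix.trace_fin_two, eM_apply n hω, eM_apply n hω, ← mul_add, ← Finset.sum_add_distrib,
    Finset.sum_eq_zero, mul_zero]
  intro j _
  have hj : ω ^ j ≠ 0 := pow_ne_zero j hω
  simp only [Matrix.cons_val_zero, Matrix.cons_val_one, one_pow, inv_one, one_mul, mul_one]
  rw [mul_right_comm (ω ^ j), mul_inv_cancel₀ hj, one_mul, ← mul_add, hx, mul_zero]

theorem mul_add_mul_eq_zero_of_diagonal_of_offDiagonal {R : Type*} [CommRing R]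
    {A B : Matrix (Fin 2) (Fin 2) R} (hA : ∀ a b, a ≠ b → A a b = 0) (htr : A.trace = 0)
    (hB : ∀ a, B a a = 0) : A * B + B * A = 0 := by
  rw [Matrix.trace_fin_two] at htr
  have h₀₁ := hA 0 1 (by decide)
  have h₁₀ := hA 1 0 (by decide)
  ext a b
  fin_cases a <;> fin_cases b <;>
    simp [Matrix.mul_apply, Fin.sum_univ_two, hB, h₀₁, h₁₀] <;> linear_combination B _ _ * htr

/-- For every `α ∈ {1, n-1}`, every `f ∈ {e_α, he_α}`, and all `x₁, x₂ ∈ sl₂(ℂ)`,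
`e₀(x₁) f(x₂) + f(x₂) e₀(x₁) = 0`. -/
theorem e_zero_anticommutes_f (n : ℕ) (hn : 3 ≤ n) (ω : ℂ) (hω : IsPrimitiveRoot ω n)
    (α : ℕ) (hα : α ∈ ({1, n - 1} : Set ℕ))
    (f : M2 → M2) (hf : f = eM n ω α ∨ f = hem n ω α)
    (x₁ x₂ : M2) (hx₁ : Matrix.trace x₁ = 0) (hx₂ : Matrix.trace x₂ = 0) :
    eM n ω 0 x₁ * f x₂ + f x₂ * eM n ω 0 x₁ = 0 := by
  have hω₀ : ω ≠ 0 := hω.ne_zero (by omega)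
  have hω₁ : ω ≠ 1 := hω.ne_one (by omega)
  have hnα : ¬ n ∣ α := by
    rcases hα with rfl | rfl <;> exact Nat.not_dvd_of_pos_of_lt (by omega) (by omega)
  have he (a : Fin 2) := eM_apply_self_of_not_dvd hω hω₀ hnα x₂ a
  refine mul_add_mul_eq_zero_of_diagonal_of_offDiagonal
    (fun a b hab => eM_zero_apply_of_ne hω hω₀ hω₁ x₁ hab) (trace_eM n hω₀ 0 hx₁) fun a => ?_
  rcases hf with rfl | rfl
  · exact he a
  · fin_cases a <;> simp [hem, Hmat, Matrix.vecMul_eq_sum, he]
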